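/- There exists a universal constant C ≥ 1 such that under Assumption 1, if α_g = 1, η ≤ 1/(LH), and additionally the effective step-size α = Hη satisfies α ≤ 1/(C·τ̄·L) for a given integer τ̄ ≥ 1, then the FedHSA iterates satisfy, deterministically for every realization of the observation sequences: ‖θ̄^{(2τ̄)} − θ*‖ ≤ C·(‖θ̄^{(0)} − θ*‖ + σ). -/

import Mathlib

open MeasureTheory ProbabilityTheory Filter Finset
open scoped RealInnerProductSpace

/-- The true (mean-path) operator `Ḡ(θ) := E_{o ∼ μ}[G(θ, o)]`. -/
noncomputable def Gbar {d : ℕ} {𝒳 : Type} [MeasurableSpace 𝒳]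
    (G : EuclideanSpace ℝ (Fin d) → 𝒳 → EuclideanSpace ℝ (Fin d))
    (μ : Measure 𝒳) (θ : EuclideanSpace ℝ (Fin d)) : EuclideanSpace ℝ (Fin d) :=
  ∫ x, G θ x ∂μ

/-- The FedHSA local iterates within round `t`, started from the global parameter `θb`:
`θ_{i,ℓ+1}^{(t)} = θ_{i,ℓ}^{(t)} + η (G_i(θ_{i,ℓ}^{(t)}, o_{i,ℓ}^{(t)}) + G(θb) - G_i(θb, o_{i,0}^{(t)}))`,
where `o_{i,ℓ}^{(t)} = o_i(tH+ℓ)` and `G(θb) = (1/M) ∑_j G_j(θb, o_{j,0}^{(t)})`. -/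
noncomputable def hsaLocal {d M : ℕ} {𝒳 Ω : Type}
    (G : Fin M → EuclideanSpace ℝ (Fin d) → 𝒳 → EuclideanSpace ℝ (Fin d))
    (o : Fin M → ℕ → Ω → 𝒳) (η : ℝ) (H t : ℕ)
    (θb : EuclideanSpace ℝ (Fin d)) (ω : Ω) (i : Fin M) :
    ℕ → EuclideanSpace ℝ (Fin d)
  | 0 => θb
  | ℓ + 1 =>
      hsaLocal G o η H t θb ω i ℓ +
        η • (G i (hsaLocal G o η H t θb ω i ℓ) (o i (t * H + ℓ) ω) +
          (M : ℝ)⁻¹ • ∑ j, G j θb (o j (t * H) ω) - G i θb (o i (t * H) ω))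

/-- The FedHSA global (server) iterates: `θ̄^{(0)} = θ0` and
`θ̄^{(t+1)} = θ̄^{(t)} + (αg/M) ∑_i (θ_{i,H}^{(t)} - θ̄^{(t)})`. -/
noncomputable def hsaGlobal {d M : ℕ} {𝒳 Ω : Type}
    (G : Fin M → EuclideanSpace ℝ (Fin d) → 𝒳 → EuclideanSpace ℝ (Fin d))
    (o : Fin M → ℕ → Ω → 𝒳) (η αg : ℝ) (H : ℕ)
    (θ0 : EuclideanSpace ℝ (Fin d)) : ℕ → Ω → EuclideanSpace ℝ (Fin d)
  | 0 => fun _ => θ0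
  | t + 1 => fun ω =>
      hsaGlobal G o η αg H θ0 t ω +
        (αg / (M : ℝ)) • ∑ i,
          (hsaLocal G o η H t (hsaGlobal G o η αg H θ0 t ω) ω i H -
            hsaGlobal G o η αg H θ0 t ω)

section Growth

variable {d M : ℕ} {𝒳 Ω : Type}
  {G : Fin M → EuclideanSpace ℝ (Fin d) → 𝒳 → EuclideanSpace ℝ (Fin d)}
  {o : Fin M → ℕ → Ω → 𝒳} {θstar : EuclideanSpace ℝ (Fin d)} {L s η : ℝ}

/-- A uniform bound on vectors bounds their average. -/
lemma norm_inv_smul_sum_le {E : Type*} [SeminormedAddCommGroup E] [NormedSpace ℝ E]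
    (hM : 0 < M) (v : Fin M → E) {B : ℝ} (hv : ∀ i, ‖v i‖ ≤ B) :
    ‖(M : ℝ)⁻¹ • ∑ i, v i‖ ≤ B := by
  have hM' : (0 : ℝ) < M := by exact_mod_cast hM
  have hsum : ‖∑ i, v i‖ ≤ M * B := by
    simpa using norm_sum_le_of_le univ (fun i _ => hv i)
  rw [norm_smul, norm_inv, Real.norm_of_nonneg hM'.le, inv_mul_le_iff₀ hM']
  exact hsum

/-- Geometric growth of the client drift within a round. -/
lemma norm_hsaLocal_sub_le (hM : 0 < M) (hη : 0 ≤ η) (hL : 0 ≤ L)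
    (hG : ∀ i θ x, ‖G i θ x‖ ≤ L * (‖θ - θstar‖ + s)) (H t : ℕ)
    (θb : EuclideanSpace ℝ (Fin d)) (ω : Ω) (i : Fin M) (ℓ : ℕ) :
    ‖hsaLocal G o η H t θb ω i ℓ - θb‖ ≤
      ((1 + η * L) ^ ℓ - 1) * (3 * (‖θb - θstar‖ + s)) := by
  induction ℓ with
  | zero => simp [hsaLocal]
  | succ ℓ ih =>
    set θ := hsaLocal G o η H t θb ω i ℓ with hθ
    set W := ‖θb - θstar‖ + s with hW
    have htri : ‖θ - θstar‖ ≤ ‖θ - θb‖ + ‖θb - θstar‖ := norm_sub_le_norm_sub_add_norm_sub ..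
    have h₁ : ‖G i θ (o i (t * H + ℓ) ω)‖ ≤ L * (‖θ - θb‖ + W) :=
      (hG i θ _).trans (mul_le_mul_of_nonneg_left (by linarith) hL)
    have h₂ : ‖(M : ℝ)⁻¹ • ∑ j, G j θb (o j (t * H) ω)‖ ≤ L * W :=
      norm_inv_smul_sum_le hM _ fun j => hG j θb _
    have h₃ : ‖G i θb (o i (t * H) ω)‖ ≤ L * W := hG i θb _
    have hstep : ‖G i θ (o i (t * H + ℓ) ω) + (M : ℝ)⁻¹ • ∑ j, G j θb (o j (t * H) ω) -
        G i θb (o i (t * H) ω)‖ ≤ L * (‖θ - θb‖ + 3 * W) := by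
      refine (norm_sub_le _ _).trans ?_
      refine (add_le_add_left (norm_add_le _ _) _).trans ?_
      linarith
    have hηL : 0 ≤ 1 + η * L := by positivity
    calc ‖hsaLocal G o η H t θb ω i (ℓ + 1) - θb‖
        ≤ ‖θ - θb‖ + η * (L * (‖θ - θb‖ + 3 * W)) := by
          rw [hsaLocal, ← hθ, add_sub_right_comm]
          refine (norm_add_le _ _).trans ?_
          rw [norm_smul, Real.norm_of_nonneg hη]
          gcongr
      _ = (1 + η * L) * ‖θ - θb‖ + η * L * (3 * W) := by ring
      _ ≤ (1 + η * L) * (((1 + η * L) ^ ℓ - 1) * (3 * W)) + η * L * (3 * W) := by gcongr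
      _ = ((1 + η * L) ^ (ℓ + 1) - 1) * (3 * W) := by ring

/-- Geometric growth of the server iterates. -/
lemma norm_hsaGlobal_sub_add_le (hM : 0 < M) (hη : 0 ≤ η) (hL : 0 ≤ L) (hs : 0 ≤ s)
    (hG : ∀ i θ x, ‖G i θ x‖ ≤ L * (‖θ - θstar‖ + s)) {H : ℕ} (hα : H * (η * L) ≤ 1)
    (θ0 : EuclideanSpace ℝ (Fin d)) (ω : Ω) (t : ℕ) :
    ‖hsaGlobal G o η 1 H θ0 t ω - θstar‖ + s ≤
      Real.exp (t * (6 * (H * (η * L)))) * (‖θ0 - θstar‖ + s) := by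
  have hexp : (1 + η * L) ^ H - 1 ≤ 2 * (H * (η * L)) := by
    have h₁ : (1 + η * L) ^ H ≤ Real.exp (H * (η * L)) := by
      rw [Real.exp_nat_mul]
      gcongr
      linarith [Real.add_one_le_exp (η * L)]
    have hnn : 0 ≤ H * (η * L) := by positivity
    have h₂ := Real.abs_exp_sub_one_le (x := H * (η * L)) (by rwa [abs_of_nonneg hnn])
    rw [abs_of_nonneg hnn] at h₂
    linarith [le_abs_self (Real.exp (H * (η * L)) - 1)]
  induction t with
  | zero => simp [hsaGlobal]
  | succ t ih =>
    set θ := hsaGlobal G o η 1 H θ0 t ω with hθ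
    have hdrift : ‖(M : ℝ)⁻¹ • ∑ i, (hsaLocal G o η H t θ ω i H - θ)‖ ≤
        2 * (H * (η * L)) * (3 * (‖θ - θstar‖ + s)) :=
      norm_inv_smul_sum_le hM _ fun i =>
        (norm_hsaLocal_sub_le hM hη hL hG H t θ ω i H).trans (by gcongr)
    calc ‖hsaGlobal G o η 1 H θ0 (t + 1) ω - θstar‖ + s
        ≤ ‖θ - θstar‖ + 2 * (H * (η * L)) * (3 * (‖θ - θstar‖ + s)) + s := by
          simp only [hsaGlobal, ← hθ, one_div, add_sub_right_comm]
          gcongr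
          exact (norm_add_le _ _).trans (by gcongr)
      _ = (6 * (H * (η * L)) + 1) * (‖θ - θstar‖ + s) := by ring
      _ ≤ Real.exp (6 * (H * (η * L))) *
          (Real.exp (t * (6 * (H * (η * L)))) * (‖θ0 - θstar‖ + s)) := by
          gcongr
          exact Real.add_one_le_exp _
      _ = Real.exp ((t + 1 : ℕ) * (6 * (H * (η * L)))) * (‖θ0 - θstar‖ + s) := by
          rw [← mul_assoc, ← Real.exp_add]
          push_cast
          ring_nf

end Growth

/-- Deterministic bound on the first `2τ̄` rounds: there is a universal constant `C ≥ 1`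
such that with `α_g = 1`, `η ≤ 1/(LH)` and `α = Hη ≤ 1/(Cτ̄L)` for a given integer `τ̄ ≥ 1`,
`‖θ̄^{(2τ̄)} - θ*‖ ≤ C (‖θ̄^{(0)} - θ*‖ + σ)` for every realization. -/
theorem fedhsa_initial_rounds_bound :
    ∃ C : ℝ, 1 ≤ C ∧ ∀
    (d M H : ℕ) (hM : 0 < M) (hH : 0 < H)
    (𝒳 : Type) [Fintype 𝒳] [MeasurableSpace 𝒳] [MeasurableSingletonClass 𝒳]
    (Ω : Type) (o : Fin M → ℕ → Ω → 𝒳)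
    (G : Fin M → EuclideanSpace ℝ (Fin d) → 𝒳 → EuclideanSpace ℝ (Fin d))
    (μloc : Fin M → Measure 𝒳) (hμprob : ∀ i, IsProbabilityMeasure (μloc i))
    (θstar : EuclideanSpace ℝ (Fin d))
    (hroot : (M : ℝ)⁻¹ • ∑ i, Gbar (G i) (μloc i) θstar = 0)
    (L : ℝ) (hL : 1 ≤ L)
    (hLip : ∀ (i : Fin M) (x : 𝒳) (θ₁ θ₂ : EuclideanSpace ℝ (Fin d)),
      ‖G i θ₁ x - G i θ₂ x‖ ≤ L * ‖θ₁ - θ₂‖)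
    (σa : Fin M → ℝ) (hσa : ∀ i, 1 ≤ σa i)
    (hGbnd : ∀ (i : Fin M) (θ : EuclideanSpace ℝ (Fin d)) (x : 𝒳),
      ‖G i θ x‖ ≤ L * (‖θ‖ + σa i))
    (σ : ℝ) (hσ : σ = max (⨆ i, σa i) (max ‖θstar‖ 1))
    (η : ℝ) (hη : 0 < η) (θ0 : EuclideanSpace ℝ (Fin d))
    (hηs : η ≤ 1 / (L * (H : ℝ)))
    (τb : ℕ) (hτb : 1 ≤ τb)
    (hα : ((H : ℝ) * η) ≤ 1 / (C * (τb : ℝ) * L)),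
    ∀ ω : Ω,
      ‖hsaGlobal G o η 1 H θ0 (2 * τb) ω - θstar‖ ≤ C * (‖θ0 - θstar‖ + σ) := by
  refine ⟨12, by norm_num, ?_⟩
  intro d M H hM hH 𝒳 _ _ _ Ω o G μloc hμprob θstar hroot L hL hLip σa hσa hGbnd σ hσ η hη θ0
    hηs τb hτb hα ω
  have hL0 : 0 < L := by linarith
  have hτ : (1 : ℝ) ≤ τb := by exact_mod_cast hτb
  have hσi (i : Fin M) : σa i ≤ σ :=
    hσ ▸ (le_ciSup (Set.finite_range σa).bddAbove i).trans (le_max_left _ _)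
  have hσstar : ‖θstar‖ ≤ σ := hσ ▸ (le_max_left _ _).trans (le_max_right _ _)
  have hσ0 : 0 ≤ σ := (norm_nonneg _).trans hσstar
  have hG : ∀ i θ x, ‖G i θ x‖ ≤ L * (‖θ - θstar‖ + 2 * σ) := fun i θ x => by
    refine (hGbnd i θ x).trans (mul_le_mul_of_nonneg_left ?_ hL0.le)
    linarith [hσi i, norm_le_norm_sub_add θ θstar]
  rw [le_div_iff₀ (by positivity)] at hα
  have hnn : 0 ≤ (H : ℝ) * (η * L) := by positivity
  have hατ : 12 * (τb * (H * (η * L))) ≤ 1 := by linarith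
  have hα1 : (H : ℝ) * (η * L) ≤ 1 := by nlinarith
  have hgrow := norm_hsaGlobal_sub_add_le (o := o) hM hη.le hL0.le (by positivity) hG hα1 θ0 ω
    (2 * τb)
  have hexp : Real.exp ((2 * τb : ℕ) * (6 * (H * (η * L)))) ≤ 3 := by
    refine (Real.exp_le_exp.2 ?_).trans Real.exp_one_lt_three.le
    push_cast
    linarith
  have hbound := hgrow.trans (mul_le_mul_of_nonneg_right hexp (by positivity))
  linarith [norm_nonneg (θ0 - θstar)]
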